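/- The border ranks of the rectangular matrix multiplication tensors M⟨2,2,3⟩ and M⟨2,3,3⟩ are BR(M⟨2,2,3⟩) = 10 and BR(M⟨2,3,3⟩) = 14. -/

import Mathlib

open scoped BigOperators

noncomputable section

/-- A tensor `T ∈ ℂ^{ι₁} ⊗ ℂ^{ι₂} ⊗ ℂ^{ι₃}`, written in coordinates, has rank at most `r`
if it is a sum of `r` simple tensors. -/
def rankLE {ι₁ ι₂ ι₃ : Type*} (T : ι₁ → ι₂ → ι₃ → ℂ) (r : ℕ) : Prop :=
  ∃ u : Fin r → ι₁ → ℂ, ∃ v : Fin r → ι₂ → ℂ, ∃ w : Fin r → ι₃ → ℂ,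
    T = fun i j k => ∑ l, u l i * v l j * w l k

/-- The rank of a tensor. -/
def trank {ι₁ ι₂ ι₃ : Type*} (T : ι₁ → ι₂ → ι₃ → ℂ) : ℕ :=
  sInf {r | rankLE T r}

/-- The border rank of a tensor: the least `r` such that `T` is a limit of tensors of rank
at most `r` (closure in the Euclidean = product topology). -/
def brank {ι₁ ι₂ ι₃ : Type*} [Fintype ι₁] [Fintype ι₂] [Fintype ι₃]
    (T : ι₁ → ι₂ → ι₃ → ℂ) : ℕ :=
  sInf {r | T ∈ closure {S : ι₁ → ι₂ → ι₃ → ℂ | rankLE S r}}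

/-- The matrix multiplication tensor `M⟨a,b,c⟩ = Σ e_{ij} ⊗ e_{jk} ⊗ e_{ki}`. -/
def matMulTensor (a b c : ℕ) :
    (Fin a × Fin b) → (Fin b × Fin c) → (Fin c × Fin a) → ℂ :=
  fun x y z => if x.2 = y.1 ∧ y.2 = z.1 ∧ z.2 = x.1 then 1 else 0

/-- Kronecker product of tensors. -/
def kron {ι₁ ι₂ ι₃ κ₁ κ₂ κ₃ : Type*} (T : ι₁ → ι₂ → ι₃ → ℂ) (T' : κ₁ → κ₂ → κ₃ → ℂ) :
    (ι₁ × κ₁) → (ι₂ × κ₂) → (ι₃ × κ₃) → ℂ :=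
  fun i j k => T i.1 j.1 k.1 * T' i.2 j.2 k.2

/-- The little Coppersmith–Winograd tensor
`cw_q = Σ_{i=1}^q (e₀⊗eᵢ⊗eᵢ + eᵢ⊗e₀⊗eᵢ + eᵢ⊗eᵢ⊗e₀)`. -/
def cw (q : ℕ) : Fin (q + 1) → Fin (q + 1) → Fin (q + 1) → ℂ :=
  fun i j k =>
    if (i.val = 0 ∧ j = k ∧ j.val ≠ 0) ∨ (j.val = 0 ∧ i = k ∧ i.val ≠ 0) ∨
       (k.val = 0 ∧ i = j ∧ i.val ≠ 0)
    then 1 else 0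

/-- The big Coppersmith–Winograd tensor `CW_{m-2} ∈ ℂ^m ⊗ ℂ^m ⊗ ℂ^m` (for `m ≥ 3`). -/
def bigCW (m : ℕ) : Fin m → Fin m → Fin m → ℂ :=
  fun i j k =>
    if (i.val = 0 ∧ j.val = 0 ∧ k.val = m - 1) ∨
       (i.val = 0 ∧ j.val = m - 1 ∧ k.val = 0) ∨
       (i.val = m - 1 ∧ j.val = 0 ∧ k.val = 0) ∨
       (i.val = 0 ∧ j = k ∧ 1 ≤ j.val ∧ j.val ≤ m - 2) ∨
       (j.val = 0 ∧ i = k ∧ 1 ≤ i.val ∧ i.val ≤ m - 2) ∨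
       (k.val = 0 ∧ i = j ∧ 1 ≤ i.val ∧ i.val ≤ m - 2)
    then 1 else 0

/-- The skew Coppersmith–Winograd tensor `T_{skewcw,2} ∈ ℂ³⊗ℂ³⊗ℂ³`. -/
def skewCW2 : Fin 3 → Fin 3 → Fin 3 → ℂ :=
  fun i j k =>
    if (i = 0 ∧ j = 1 ∧ k = 1) ∨ (i = 0 ∧ j = 2 ∧ k = 2) ∨ (i = 1 ∧ j = 0 ∧ k = 1) ∨
       (i = 2 ∧ j = 0 ∧ k = 2) ∨ (i = 1 ∧ j = 2 ∧ k = 0)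
    then 1
    else if i = 2 ∧ j = 1 ∧ k = 0 then -1 else 0

/-- Action of a triple of linear maps (matrices) on a tensor. -/
def triApply {a b c a' b' c' : ℕ}
    (g₁ : Matrix (Fin a') (Fin a) ℂ) (g₂ : Matrix (Fin b') (Fin b) ℂ)
    (g₃ : Matrix (Fin c') (Fin c) ℂ) (T : Fin a → Fin b → Fin c → ℂ) :
    Fin a' → Fin b' → Fin c' → ℂ :=
  fun i j k => ∑ i', ∑ j', ∑ k', g₁ i i' * g₂ j j' * g₃ k k' * T i' j' k'

/-- The unit (diagonal) tensor `I_r ∈ ℂ^r ⊗ ℂ^r ⊗ ℂ^r`. -/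
def unitTensor (r : ℕ) : Fin r → Fin r → Fin r → ℂ :=
  fun i j k => if i = j ∧ j = k then 1 else 0

/-- The unit tensor `I_r = Σ_{ℓ=1}^r a_ℓ⊗b_ℓ⊗c_ℓ` embedded in `ℂ^a ⊗ ℂ^b ⊗ ℂ^c`
(for `r ≤ min{a,b,c}`). -/
def unitIn (a b c r : ℕ) : Fin a → Fin b → Fin c → ℂ :=
  fun i j k => if i.val = j.val ∧ j.val = k.val ∧ i.val < r then 1 else 0

/-- The subrank `Q(T)`: largest `r` so that linear maps take `T` to the unit tensor `I_r`. -/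
def subrank {a b c : ℕ} (T : Fin a → Fin b → Fin c → ℂ) : ℕ :=
  sSup {r | ∃ f : Matrix (Fin r) (Fin a) ℂ, ∃ g : Matrix (Fin r) (Fin b) ℂ,
    ∃ h : Matrix (Fin r) (Fin c) ℂ, triApply f g h T = unitTensor r}

/-- The `GL(A) × GL(B) × GL(C)`-orbit of a tensor. -/
def glOrbit {a b c : ℕ} (T : Fin a → Fin b → Fin c → ℂ) :
    Set (Fin a → Fin b → Fin c → ℂ) :=
  {S | ∃ g₁ : Matrix (Fin a) (Fin a) ℂ, ∃ g₂ : Matrix (Fin b) (Fin b) ℂ,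
    ∃ g₃ : Matrix (Fin c) (Fin c) ℂ, IsUnit g₁ ∧ IsUnit g₂ ∧ IsUnit g₃ ∧
      S = triApply g₁ g₂ g₃ T}

/-- The border subrank `Q̲(T)`: largest `r` (with `r ≤ min{a,b,c}`) such that `I_r` lies in
the closure of the `GL×GL×GL`-orbit of `T`. -/
def bsubrank {a b c : ℕ} (T : Fin a → Fin b → Fin c → ℂ) : ℕ :=
  sSup {r | r ≤ min a (min b c) ∧ unitIn a b c r ∈ closure (glOrbit T)}

/-- Multilinear rank in the `A`-factor: rank of the contraction `T_A : A* → B⊗C`. -/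
def mlA {a b c : ℕ} (T : Fin a → Fin b → Fin c → ℂ) : ℕ :=
  (Matrix.of fun (i : Fin a) (p : Fin b × Fin c) => T i p.1 p.2).rank

/-- Multilinear rank in the `B`-factor. -/
def mlB {a b c : ℕ} (T : Fin a → Fin b → Fin c → ℂ) : ℕ :=
  (Matrix.of fun (j : Fin b) (p : Fin a × Fin c) => T p.1 j p.2).rank

/-- Multilinear rank in the `C`-factor. -/
def mlC {a b c : ℕ} (T : Fin a → Fin b → Fin c → ℂ) : ℕ :=
  (Matrix.of fun (k : Fin c) (p : Fin a × Fin b) => T p.1 p.2 k).rank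

/-- `T` is `1_A`-generic: some contraction `T(α) : B* → C` has full rank `m`. -/
def oneAGeneric {m : ℕ} (T : Fin m → Fin m → Fin m → ℂ) : Prop :=
  ∃ α : Fin m → ℂ, (Matrix.of fun j k => ∑ i, α i * T i j k).rank = m

def oneBGeneric {m : ℕ} (T : Fin m → Fin m → Fin m → ℂ) : Prop :=
  ∃ β : Fin m → ℂ, (Matrix.of fun i k => ∑ j, β j * T i j k).rank = m

def oneCGeneric {m : ℕ} (T : Fin m → Fin m → Fin m → ℂ) : Prop :=
  ∃ γ : Fin m → ℂ, (Matrix.of fun i j => ∑ k, γ k * T i j k).rank = m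

/-- `T` is `1`-generic. -/
def oneGeneric {m : ℕ} (T : Fin m → Fin m → Fin m → ℂ) : Prop :=
  oneAGeneric T ∧ oneBGeneric T ∧ oneCGeneric T

/-- The symmetry Lie algebra `g̃_T ⊂ gl(A) ⊕ gl(B) ⊕ gl(C)` of a tensor, as a set. -/
def symLieSet {m : ℕ} (T : Fin m → Fin m → Fin m → ℂ) :
    Set (Matrix (Fin m) (Fin m) ℂ × Matrix (Fin m) (Fin m) ℂ × Matrix (Fin m) (Fin m) ℂ) :=
  {XYZ | ∀ i j k, (∑ i', XYZ.1 i i' * T i' j k) + (∑ j', XYZ.2.1 j j' * T i j' k) +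
    (∑ k', XYZ.2.2 k k' * T i j k') = 0}



/-! ### Upper bounds -/

/-- weight of a coordinate -/
def wtI {a b c : ℕ} (p : Fin a → ℤ) (q : Fin b → ℤ) (r : Fin c → ℤ)
    (x : Fin a × Fin b) (y : Fin b × Fin c) (z : Fin c × Fin a) : ℤ :=
  (p x.1 - q x.2) + (q y.1 - r y.2) + (r z.1 - p z.2)

lemma upper_of_masked {a b c R : ℕ} (p : Fin a → ℤ) (q : Fin b → ℤ) (r : Fin c → ℤ)
    (D : ℤ) (hD : D ≠ 0) (K : Fin R → ℤ) (X : Fin R → Fin a × Fin b → ℤ)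
    (Y : Fin R → Fin b × Fin c → ℤ) (Z : Fin R → Fin c × Fin a → ℤ)
    (H : ∀ x y z, wtI p q r x y z ≤ 0 → ∑ l, K l * X l x * Y l y * Z l z =
      if x.2 = y.1 ∧ y.2 = z.1 ∧ z.2 = x.1 then D else 0) :
    matMulTensor a b c ∈ closure {S | rankLE S R} := by
  let S : ℂ → (Fin a × Fin b) → (Fin b × Fin c) → (Fin c × Fin a) → ℂ := fun e x y z =>
    e ^ (wtI p q r x y z) * ((D : ℂ)⁻¹ * ((∑ l, K l * X l x * Y l y * Z l z : ℤ) : ℂ))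
  have hDc : (D : ℂ) ≠ 0 := by exact_mod_cast hD
  have hlim : Filter.Tendsto S (nhdsWithin 0 {0}ᶜ) (nhds (matMulTensor a b c)) := by
    rw [tendsto_pi_nhds]; intro x
    rw [tendsto_pi_nhds]; intro y
    rw [tendsto_pi_nhds]; intro z
    by_cases hw : wtI p q r x y z ≤ 0
    · refine tendsto_const_nhds.congr' ?_
      filter_upwards [self_mem_nhdsWithin] with e he
      have he' : e ≠ 0 := he
      simp only [S, H x y z hw, matMulTensor]
      split_ifs with h
      · have : wtI p q r x y z = 0 := by
          simp only [wtI, h.1, h.2.1, h.2.2]; ring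
        rw [this]; field_simp
      · simp
    · push Not at hw
      have h0 : matMulTensor a b c x y z = 0 := by
        unfold matMulTensor
        rw [if_neg]
        intro h
        have : wtI p q r x y z = 0 := by
          simp only [wtI, h.1, h.2.1, h.2.2]; ring
        omega
      rw [h0]
      obtain ⟨n, hn⟩ := Int.eq_ofNat_of_zero_le hw.le
      have hn0 : n ≠ 0 := by rintro rfl; simp at hn; omega
      simp only [S, hn]
      have : Filter.Tendsto (fun e : ℂ => e ^ ((n : ℕ) : ℤ) *
          ((D : ℂ)⁻¹ * ((∑ l, K l * X l x * Y l y * Z l z : ℤ) : ℂ))) (nhds 0)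
          (nhds (0 ^ ((n : ℕ) : ℤ) *
          ((D : ℂ)⁻¹ * ((∑ l, K l * X l x * Y l y * Z l z : ℤ) : ℂ)))) := by
        simp only [zpow_natCast]
        exact (continuous_id.pow n |>.mul continuous_const).tendsto 0
      rw [zpow_natCast, zero_pow hn0, zero_mul] at this
      exact this.mono_left nhdsWithin_le_nhds
  refine mem_closure_of_tendsto hlim ?_
  filter_upwards [self_mem_nhdsWithin] with e he
  have he' : e ≠ 0 := he
  refine ⟨fun l x => e ^ (p x.1 - q x.2) * ((D : ℂ)⁻¹ * K l * X l x),
    fun l y => e ^ (q y.1 - r y.2) * Y l y, fun l z => e ^ (r z.1 - p z.2) * Z l z, ?_⟩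
  funext x y z
  simp only [S, wtI]
  rw [zpow_add₀ he', zpow_add₀ he']
  push_cast
  rw [Finset.mul_sum, Finset.mul_sum]
  refine Finset.sum_congr rfl fun l _ => ?_
  ring

def ubKA : Fin 14 → ℤ :=
  ![96443756640, 6878519170375929428735460, 2751407668150371771494184, 1650844600890223062896510400, 3439259585187964714367730, 18615748769623624976280, 633906092, 8933141779708999258098, 1108015216, 27514076681503717714941840, 30451344, 55588928472, 6276297275027857, 252835222101]
def ubXA : Fin 14 → Fin 6 → ℤ :=
  ![![56903, 0, 27104, 899363, 0, 0],
    ![0, 0, 0, 0, 1, 4],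
    ![0, 1, 0, 0, 0, 0],
    ![0, -1, 2, 0, 0, 0],
    ![0, 1, 0, 0, 0, 8],
    ![-739, 739, -352, 0, 0, 0],
    ![3785642784, 0, -149581566288, 0, 0, 203350884955],
    ![0, 77, 0, -15, 0, 0],
    ![-273987945, 0, 10829012040, -292080, 90631207, 0],
    ![0, 2, 0, 0, 1, 0],
    ![-739, 0, 29208, 0, 0, 0],
    ![739, 0, 352, 0, 0, 0],
    ![0, 0, 0, -3, 4, 0],
    ![0, 0, 0, 1, 0, 0]]
def ubYA : Fin 14 → Fin 9 → ℤ :=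
  ![![-160, 9736, 120, -160, 0, 0, 0, 0, 3],
    ![0, 0, 0, 0, 60, 4, 0, 0, 1],
    ![0, -10, 0, 0, 20, -20, 0, 20, -1],
    ![0, 0, 2, 0, -1, -1, 0, 1, 0],
    ![0, 0, -8, 0, 0, 0, 0, 16, -1],
    ![0, 120, -120, 160, 0, 0, 0, 0, -3],
    ![0, 0, 0, 0, 0, 0, 1, 0, 0],
    ![0, 40, -40, 0, 0, 0, 0, 0, -1],
    ![0, -4868, 0, 3695, 0, 0, 0, 0, 3695],
    ![0, 0, 0, 0, 1, -1, 0, 0, 0],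
    ![0, 0, 0, -3695, 0, 0, 7302, 0, -3695],
    ![591200, 0, -443400, 591200, 0, 0, 14604, 0, -11085],
    ![-886800, 4868, 0, 1182400, 0, 0, 0, 0, -3695],
    ![51352474460, 23456608908, 284662800, 87676142400, 0, 0, 0, 0, -266871375]]
def ubZA : Fin 14 → Fin 6 → ℤ :=
  ![![90631207, -1533420, 0, 0, 0, 0],
    ![-4, 0, 0, 15, 0, 0],
    ![4, 0, 60, -15, -120, 0],
    ![0, 0, 2, 0, 0, -8],
    ![-4, 0, 0, 15, 120, -240],
    ![3, 0, -4, 0, -2, 0],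
    ![0, 51226560, 90631207, 0, 0, 0],
    ![-176, 0, 0, -15, 0, 1200],
    ![74471, 55440, 0, 0, 0, 0],
    ![-4, 0, 0, 15, 0, -240],
    ![1004646929595, 747910270800, 0, 0, -1985367220542, 0],
    ![275170345, -55440, -362524828, 0, -543787242, 0],
    ![1280, 221760, 0, 1112265, 0, 0],
    ![0, 221760, 0, 1117065, 0, 2383072]]
def ubKB : Fin 10 → ℤ :=
  ![1, 1, 1, 2, 1, 2, 1, 2, 2, 2]
def ubXB : Fin 10 → Fin 4 → ℤ :=
  ![![0, 1, 1, 1],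
    ![0, 1, -1, -1],
    ![0, 0, 0, 1],
    ![0, 0, 1, 0],
    ![0, 1, 1, 0],
    ![0, 1, 0, 0],
    ![0, 1, -1, 0],
    ![1, 0, 0, 0],
    ![1, 0, 0, 0],
    ![1, 0, 1, 0]]
def ubYB : Fin 10 → Fin 6 → ℤ :=
  ![![2, 0, 0, 0, -1, 0],
    ![2, 0, 2, 0, -1, 2],
    ![0, 0, 0, 2, 1, 0],
    ![0, 1, 0, 0, -1, 1],
    ![0, 0, 0, 0, 1, 0],
    ![0, 0, 0, 1, 0, 0],
    ![0, 0, 0, 0, -1, 2],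
    ![0, 1, 1, 0, 0, 0],
    ![1, 0, 0, 0, 0, 0],
    ![0, 1, 0, 0, 0, 0]]
def ubZB : Fin 10 → Fin 6 → ℤ :=
  ![![0, 1, -1, -1, 0, -1],
    ![0, 0, -1, 0, 0, -1],
    ![0, 1, 0, 1, 0, 0],
    ![0, 0, 0, 1, 1, 0],
    ![0, 1, 0, 0, 1, -1],
    ![1, 0, 0, 0, 0, 0],
    ![0, 0, 0, 1, 1, 1],
    ![0, 0, 1, 0, 1, 0],
    ![1, 0, 0, 0, 0, 0],
    ![0, 0, 0, 0, -1, 0]]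

lemma upper_233 : matMulTensor 2 3 3 ∈ closure {S | rankLE S 14} := by
  refine upper_of_masked ![2, 4] ![7, 6, 1] ![3, 4, 7] 6603378403560892251586041600 (by norm_num)
    ubKA (fun l x => ubXA l (finProdFinEquiv x)) (fun l x => ubYA l (finProdFinEquiv x))
    (fun l x => ubZA l (finProdFinEquiv x)) ?_
  decide +kernel

lemma upper_223 : matMulTensor 2 2 3 ∈ closure {S | rankLE S 10} := by
  refine upper_of_masked ![3, 3] ![2, 1] ![1, 3, 1] 2 (by norm_num)
    ubKB (fun l x => ubXB l (finProdFinEquiv x)) (fun l x => ubYB l (finProdFinEquiv x))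
    (fun l x => ubZB l (finProdFinEquiv x)) ?_
  decide +kernel

/-! ### Lower bounds: combinatorial block bounds -/

/-- determining coordinates of a diagonal block (bit masks) -/
def tab1 : List ℕ := [0, 68, 129, 197, 3, 71, 139, 207]

/-- determining coordinates of an off-diagonal block (bit masks) -/
def tab2 : List ℕ := [0, 0, 0, 4, 0, 0, 1, 5, 0, 68, 16, 84, 0, 68, 17, 85, 0, 4, 129, 133, 32, 36, 161, 165, 16, 84, 145, 213, 48, 116, 177, 245, 0, 0, 8, 12, 3, 3, 11, 15, 0, 68, 24, 92, 3, 71, 27, 95, 1, 5, 137, 141, 35, 39, 171, 175, 17, 85, 153, 221, 51, 119, 187, 255]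

def code3 (e h f : Bool) : ℕ := 4 * e.toNat + 2 * h.toNat + f.toNat

def bitAt (a b c : Fin 2) : ℕ := 4 * a.val + 2 * b.val + c.val

def inJ1 (e h f : Bool) (a b c : Fin 2) : Bool :=
  (tab1.getD (code3 e h f) 0).testBit (bitAt a b c)

def inJ2 (e h f e' h' f' : Bool) (a b c : Fin 2) : Bool :=
  (tab2.getD (8 * code3 e h f + code3 e' h' f') 0).testBit (bitAt a b c)

lemma block2 (e h f e' h' f' : Bool) (x : Fin 2 → Fin 2 → Fin 2 → ℂ)
    (h1 : e' = false → ∀ v, x v 0 1 = 0) (h2 : f' = false → ∀ v, x v 1 0 = 0)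
    (h3 : h' = false → ∀ v, x v 0 0 = x v 1 1)
    (h4 : e = false → ∀ v, x 0 v 1 = 0) (h5 : f = false → ∀ v, x 1 v 0 = 0)
    (h6 : h = false → ∀ v, x 0 v 0 = x 1 v 1)
    (hJ : ∀ a b c, inJ2 e h f e' h' f' a b c = true → x a b c = 0) :
    ∀ a b c, x a b c = 0 := by
  simp only [Fin.forall_fin_two, Fin.isValue] at *
  cases e <;> cases h <;> cases f <;> cases e' <;> cases h' <;> cases f' <;>
    simp [inJ2, tab2, code3, bitAt, Nat.testBit] at hJ <;> grind

lemma block1 (e h f : Bool) (x : Fin 2 → Fin 2 → Fin 2 → ℂ)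
    (h1 : e = false → ∀ v, x v 0 1 = 0) (h2 : f = false → ∀ v, x v 1 0 = 0)
    (h3 : h = false → ∀ v, x v 0 0 = x v 1 1)
    (hs : ∀ a b c, x a b c = x b a c)
    (hJ : ∀ a b c, inJ1 e h f a b c = true → x a b c = 0) :
    ∀ a b c, x a b c = 0 := by
  simp only [Fin.forall_fin_two, Fin.isValue] at *
  cases e <;> cases h <;> cases f <;>
    simp [inJ1, tab1, code3, bitAt, Nat.testBit] at hJ <;> grind

def J1 (e h f : Bool) : Finset (Fin 2 × Fin 2 × Fin 2) :=
  Finset.univ.filter fun a => inJ1 e h f a.1 a.2.1 a.2.2 = true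

def J2 (e h f e' h' f' : Bool) : Finset (Fin 2 × Fin 2 × Fin 2) :=
  Finset.univ.filter fun a => inJ2 e h f e' h' f' a.1 a.2.1 a.2.2 = true

def cnt (e h f : Bool) : ℕ := e.toNat + h.toNat + f.toNat

def ppT (a b : ℕ) : ℕ :=
  ([[0, 0, 1, 2], [0, 2, 3, 4], [1, 3, 5, 6], [2, 4, 6, 8]].getD a []).getD b 0

lemma card_J1 : ∀ e h f : Bool, (J1 e h f).card ≤ 2 * cnt e h f := by decide +kernel

lemma card_J2 : ∀ e h f e' h' f' : Bool,
    (J2 e h f e' h' f').card ≤ ppT (cnt e h f) (cnt e' h' f') := by decide +kernel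

/-- total bound -/
def totB {U W : Type*} [Fintype U] [Fintype W] [LinearOrder U] (c : U → W → ℕ) : ℕ :=
  ∑ k : U × U × W, if k.1 = k.2.1 then 2 * c k.1 k.2.2
    else if k.1 < k.2.1 then ppT (c k.1 k.2.2) (c k.2.1 k.2.2) else 0

lemma symBound {U W : Type*} [Fintype U] [Fintype W] [LinearOrder U]
    (e h f : U → W → Bool) {N : Type*} [AddCommGroup N] [Module ℂ N]
    (Φ : N →ₗ[ℂ] (U → Fin 2 → U → Fin 2 → Fin 2 → W → ℂ)) (hinj : Function.Injective Φ)
    (hsym : ∀ x u v u' v' y w, Φ x u v u' v' y w = Φ x u' v' u v y w)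
    (h01 : ∀ x u v u' w, e u' w = false → Φ x u v u' 0 1 w = 0)
    (h10 : ∀ x u v u' w, f u' w = false → Φ x u v u' 1 0 w = 0)
    (h00 : ∀ x u v u' w, h u' w = false → Φ x u v u' 0 0 w = Φ x u v u' 1 1 w) :
    Module.finrank ℂ N ≤ totB (fun u w => cnt (e u w) (h u w) (f u w)) := by
  classical
  let Jf : U × U × W → Finset (Fin 2 × Fin 2 × Fin 2) := fun k =>
    if k.1 = k.2.1 then J1 (e k.1 k.2.2) (h k.1 k.2.2) (f k.1 k.2.2)
    else if k.1 < k.2.1 then J2 (e k.1 k.2.2) (h k.1 k.2.2) (f k.1 k.2.2)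
      (e k.2.1 k.2.2) (h k.2.1 k.2.2) (f k.2.1 k.2.2) else ∅
  let I : Finset (Σ _ : U × U × W, Fin 2 × Fin 2 × Fin 2) := Finset.univ.sigma Jf
  let G : N →ₗ[ℂ] (I → ℂ) :=
    { toFun := fun x i => Φ x i.1.1.1 i.1.2.1 i.1.1.2.1 i.1.2.2.1 i.1.2.2.2 i.1.1.2.2
      map_add' := by intro x y; funext i; simp
      map_smul' := by intro x y; funext i; simp }
  have hG : Function.Injective G := by
    rw [← LinearMap.ker_eq_bot, LinearMap.ker_eq_bot']
    intro x hx
    apply hinj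
    rw [LinearMap.map_zero]
    have key : ∀ u u' w v v' y, ((v, v', y) ∈ Jf (u, u', w)) → Φ x u v u' v' y w = 0 := by
      intro u u' w v v' y hm
      have := congrFun hx ⟨⟨(u, u', w), (v, v', y)⟩, by simpa [I] using hm⟩
      simpa [G] using this
    have hdiag : ∀ u w v v' y, Φ x u v u v' y w = 0 := by
      intro u w
      refine block1 (e u w) (h u w) (f u w) (fun v v' y => Φ x u v u v' y w) ?_ ?_ ?_ ?_ ?_
      · intro hh v; exact h01 _ _ _ _ _ hh
      · intro hh v; exact h10 _ _ _ _ _ hh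
      · intro hh v; exact h00 _ _ _ _ _ hh
      · intro a b c; exact hsym _ _ _ _ _ _ _
      · intro a b c hj
        apply key; simp [Jf, J1, hj]
    have hoff : ∀ u u' w, u < u' → ∀ v v' y, Φ x u v u' v' y w = 0 := by
      intro u u' w huu
      refine block2 (e u w) (h u w) (f u w) (e u' w) (h u' w) (f u' w)
        (fun v v' y => Φ x u v u' v' y w) ?_ ?_ ?_ ?_ ?_ ?_ ?_
      · intro hh v; exact h01 _ _ _ _ _ hh
      · intro hh v; exact h10 _ _ _ _ _ hh
      · intro hh v; exact h00 _ _ _ _ _ hh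
      · intro hh v; simp only [hsym x u]; exact h01 _ _ _ _ _ hh
      · intro hh v; simp only [hsym x u]; exact h10 _ _ _ _ _ hh
      · intro hh v; simp only [hsym x u]; exact h00 _ _ _ _ _ hh
      · intro a b c hj
        apply key; simp [Jf, J2, hj, huu, huu.ne]
    funext u v u' v' y w
    rcases lt_trichotomy u u' with hlt | heq | hgt
    · exact hoff u u' w hlt _ _ _
    · subst heq; exact hdiag _ _ _ _ _
    · rw [hsym]; exact hoff u' u w hgt _ _ _
  have h1 := LinearMap.finrank_le_finrank_of_injective hG
  rw [Module.finrank_fintype_fun_eq_card, Fintype.card_coe, Finset.card_sigma] at h1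
  refine h1.trans ?_
  unfold totB
  refine Finset.sum_le_sum fun k _ => ?_
  simp only [Jf]
  split_ifs
  · exact card_J1 _ _ _
  · exact card_J2 _ _ _ _ _ _
  · simp

set_option synthInstance.maxSize 100000 in
set_option synthInstance.maxHeartbeats 400000 in
lemma comb33_aux : ∀ a < 5, ∀ b < 5 - a, ∀ c < 5 - a - b, ∀ d < 5 - a - b - c,
    ∀ e < 5 - a - b - c - d, ∀ f < 5 - a - b - c - d - e, ∀ g < 5 - a - b - c - d - e - f,
    ∀ h < 5 - a - b - c - d - e - f - g, ∀ i < 5 - a - b - c - d - e - f - g - h,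
    a + b + c + d + e + f + g + h + i = 4 →
    totB (U := Fin 3) (W := Fin 3) ![![a, b, c], ![d, e, f], ![g, h, i]] ≤ 12 ∨
    totB (U := Fin 3) (W := Fin 3) ![![a, d, g], ![b, e, h], ![c, f, i]] ≤ 12 := by
  decide +kernel

lemma comb33 (c : Fin 3 → Fin 3 → ℕ) (hc : ∑ u, ∑ w, c u w = 4) :
    totB c ≤ 12 ∨ totB (fun w u => c u w) ≤ 12 := by
  simp only [Fin.sum_univ_three] at hc
  have := comb33_aux (c 0 0) (by omega) (c 0 1) (by omega) (c 0 2) (by omega)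
    (c 1 0) (by omega) (c 1 1) (by omega) (c 1 2) (by omega)
    (c 2 0) (by omega) (c 2 1) (by omega) (c 2 2) (by omega) (by omega)
  have e1 : (![![c 0 0, c 0 1, c 0 2], ![c 1 0, c 1 1, c 1 2], ![c 2 0, c 2 1, c 2 2]] :
      Fin 3 → Fin 3 → ℕ) = c := by
    funext i j; fin_cases i <;> fin_cases j <;> rfl
  have e2 : (![![c 0 0, c 1 0, c 2 0], ![c 0 1, c 1 1, c 2 1], ![c 0 2, c 1 2, c 2 2]] :
      Fin 3 → Fin 3 → ℕ) = fun w u => c u w := by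
    funext i j; fin_cases i <;> fin_cases j <;> rfl
  rwa [e1, e2] at this

set_option synthInstance.maxSize 100000 in
set_option synthInstance.maxHeartbeats 400000 in
lemma comb23_aux : ∀ a < 4, ∀ b < 4 - a, ∀ c < 4 - a - b, ∀ d < 4 - a - b - c,
    ∀ e < 4 - a - b - c - d, ∀ f < 4 - a - b - c - d - e,
    a + b + c + d + e + f = 3 →
    totB (U := Fin 2) (W := Fin 3) ![![a, b, c], ![d, e, f]] ≤ 8 ∨
    totB (U := Fin 3) (W := Fin 2) ![![a, d], ![b, e], ![c, f]] ≤ 8 := by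
  decide +kernel

lemma comb23 (c : Fin 2 → Fin 3 → ℕ) (hc : ∑ u, ∑ w, c u w = 3) :
    totB c ≤ 8 ∨ totB (fun w u => c u w) ≤ 8 := by
  simp only [Fin.sum_univ_three, Fin.sum_univ_two] at hc
  have := comb23_aux (c 0 0) (by omega) (c 0 1) (by omega) (c 0 2) (by omega)
    (c 1 0) (by omega) (c 1 1) (by omega) (c 1 2) (by omega) (by omega)
  have e1 : (![![c 0 0, c 0 1, c 0 2], ![c 1 0, c 1 1, c 1 2]] :
      Fin 2 → Fin 3 → ℕ) = c := by
    funext i j; fin_cases i <;> fin_cases j <;> rfl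
  have e2 : (![![c 0 0, c 1 0], ![c 0 1, c 1 1], ![c 0 2, c 1 2]] :
      Fin 3 → Fin 2 → ℕ) = fun w u => c u w := by
    funext i j; fin_cases i <;> fin_cases j <;> rfl
  rwa [e1, e2] at this

/-! ### Frames and the symmetrisation map -/

set_option linter.unusedSectionVars false

section frames

variable {α β ι ι' : Type*} [Fintype α] [Fintype β] [Fintype ι] [Fintype ι']

/-- The map whose kernel is `(A ⊗ E) ∩ (S²A ⊗ B)`, for the span `E` of the frame `f`. -/
def Psi (f : ι → α × β → ℂ) : (α → ι → ℂ) →ₗ[ℂ] (α → α → β → ℂ) where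
  toFun x := fun i j b => ∑ m, x i m * f m (j, b) - ∑ m, x j m * f m (i, b)
  map_add' x y := by
    funext i j b
    simp only [Pi.add_apply, add_mul, Finset.sum_add_distrib]; ring
  map_smul' c x := by
    funext i j b
    simp only [Pi.smul_apply, smul_eq_mul, RingHom.id_apply, mul_sub, Finset.mul_sum, mul_assoc]

def nul (f : ι → α × β → ℂ) : ℕ := Module.finrank ℂ (LinearMap.ker (Psi f))

/-- transposed frame -/
def swp (f : ι → α × β → ℂ) : ι → β × α → ℂ := fun m p => f m (p.2, p.1)

lemma mem_ker_Psi (f : ι → α × β → ℂ) (x : α → ι → ℂ) : x ∈ LinearMap.ker (Psi f) ↔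
    ∀ i j b, ∑ m, x i m * f m (j, b) = ∑ m, x j m * f m (i, b) := by
  rw [LinearMap.mem_ker]
  constructor
  · intro h i j b
    have := congrFun (congrFun (congrFun h i) j) b
    simpa [Psi, sub_eq_zero] using this
  · intro h
    funext i j b
    simpa [Psi, sub_eq_zero] using h i j b

lemma isClosed_nul (k : ℕ) : IsClosed {f : ι → α × β → ℂ | k ≤ nul f} := by
  classical
  let PsiL : (ι → α × β → ℂ) →ₗ[ℂ] ((α → ι → ℂ) →ₗ[ℂ] (α → α → β → ℂ)) :=
    { toFun := Psi
      map_add' := by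
        intro f g; ext x i j b
        simp only [Psi, LinearMap.coe_mk, AddHom.coe_mk, Pi.add_apply, mul_add,
          Finset.sum_add_distrib, LinearMap.add_apply, LinearMap.comp_apply]
        ring
      map_smul' := by
        intro c g; ext x i j b
        simp only [Psi, LinearMap.coe_mk, AddHom.coe_mk, Pi.smul_apply, smul_eq_mul,
          LinearMap.smul_apply, RingHom.id_apply, mul_sub, Finset.mul_sum, LinearMap.comp_apply]
        congr 1 <;> (refine Finset.sum_congr rfl fun m _ => ?_) <;> ring }
  let C : (ι → α × β → ℂ) →ₗ[ℂ] ((α → ι → ℂ) →L[ℂ] (α → α → β → ℂ)) :=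
    (LinearMap.toContinuousLinearMap.toLinearMap).comp PsiL
  have hC : Continuous C := LinearMap.continuous_of_finiteDimensional C
  let d := Module.finrank ℂ (α → ι → ℂ)
  have hrn : ∀ f : ι → α × β → ℂ, Module.finrank ℂ (LinearMap.range (Psi f)) + nul f = d := fun f =>
    LinearMap.finrank_range_add_finrank_ker (Psi f)
  have : {f : ι → α × β → ℂ | k ≤ nul f}ᶜ =
      C ⁻¹' {g | ((d + 1 - k : ℕ) : Cardinal) ≤ LinearMap.rank (g : (α → ι → ℂ) →ₗ[ℂ] (α → α → β → ℂ))} := by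
    ext f
    simp only [Set.mem_compl_iff, Set.mem_setOf_eq, Set.mem_preimage, not_le]
    have e : ((C f : (α → ι → ℂ) →L[ℂ] (α → α → β → ℂ)) : (α → ι → ℂ) →ₗ[ℂ] (α → α → β → ℂ)) = Psi f := rfl
    rw [e, LinearMap.rank, ← Module.finrank_eq_rank, Nat.cast_le]
    have := hrn f
    omega
  rw [← isOpen_compl_iff, this]
  exact (isOpen_setOfPred_nat_le_rank _).preimage hC

/-- For independent frames, the nullity only depends on the span (inequality version). -/
lemma nul_le_of_span (f : ι → α × β → ℂ) (g : ι' → α × β → ℂ) (hf : LinearIndependent ℂ f)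
    (hsp : ∀ m, f m ∈ Submodule.span ℂ (Set.range g)) : nul f ≤ nul g := by
  classical
  have hc : ∀ m, ∃ c : ι' → ℂ, ∑ k, c k • g k = f m := fun m =>
    (Submodule.mem_span_range_iff_exists_fun ℂ).1 (hsp m)
  choose c hc using hc
  have hc' : ∀ m p, f m p = ∑ k, c m k * g k p := by
    intro m p; rw [← hc m]; simp
  let M : (α → ι → ℂ) →ₗ[ℂ] (α → ι' → ℂ) :=
    { toFun := fun x i k => ∑ m, x i m * c m k
      map_add' := by intro x y; funext i k; simp [add_mul, Finset.sum_add_distrib]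
      map_smul' := by intro a x; funext i k; simp [Finset.mul_sum, mul_assoc] }
  have key : ∀ x i p, ∑ k, M x i k * g k p = ∑ m, x i m * f m p := by
    intro x i p
    simp only [M, LinearMap.coe_mk, AddHom.coe_mk, Finset.sum_mul, hc', Finset.mul_sum]
    rw [Finset.sum_comm]
    refine Finset.sum_congr rfl fun m _ => Finset.sum_congr rfl fun k _ => by ring
  have hM : ∀ x ∈ LinearMap.ker (Psi f), M x ∈ LinearMap.ker (Psi g) := by
    intro x hx
    rw [mem_ker_Psi] at hx ⊢
    intro i j b
    rw [key, key]; exact hx i j b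
  refine LinearMap.finrank_le_finrank_of_injective (f := M.restrict hM) ?_
  rw [← LinearMap.ker_eq_bot, LinearMap.ker_eq_bot']
  intro x hx
  have hx' : M x.1 = 0 := congrArg Subtype.val hx
  ext i m
  have h0 : ∑ m, x.1 i m • f m = 0 := by
    funext p
    have := key x.1 i p
    rw [hx'] at this
    simpa using this.symm
  exact (Fintype.linearIndependent_iff.1 hf) _ h0 m

/-- Rescaling by a diagonal torus element does not decrease the nullity. -/
lemma nul_le_scale (f : ι → α × β → ℂ) (la : α → ℂ) (lb : β → ℂ) (c : ι → ℂ)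
    (hla : ∀ i, la i ≠ 0) (hc : ∀ m, c m ≠ 0) :
    nul f ≤ nul (fun m (p : α × β) => c m * (la p.1 * lb p.2 * f m p)) := by
  let M : (α → ι → ℂ) →ₗ[ℂ] (α → ι → ℂ) :=
    { toFun := fun x i k => la i * (c k)⁻¹ * x i k
      map_add' := by intro x y; funext i k; simp [mul_add]
      map_smul' := by intro a x; funext i k; simp; ring }
  have hM : ∀ x ∈ LinearMap.ker (Psi f), M x ∈
      LinearMap.ker (Psi (fun m (p : α × β) => c m * (la p.1 * lb p.2 * f m p))) := by
    intro x hx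
    rw [mem_ker_Psi] at hx ⊢
    intro i j b
    have e : ∀ i j, ∑ m, M x i m * (c m * (la j * lb b * f m (j, b))) =
        la i * la j * lb b * ∑ m, x i m * f m (j, b) := by
      intro i j
      rw [Finset.mul_sum]
      refine Finset.sum_congr rfl fun m _ => ?_
      have := hc m
      simp only [M, LinearMap.coe_mk, AddHom.coe_mk]
      field_simp
    simp only [e, hx i j b]
    ring
  refine LinearMap.finrank_le_finrank_of_injective (f := M.restrict hM) ?_
  rw [← LinearMap.ker_eq_bot, LinearMap.ker_eq_bot']
  intro x hx
  have hx' : M x.1 = 0 := congrArg Subtype.val hx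
  ext i m
  have := congrFun (congrFun hx' i) m
  simpa [M, hla i, hc m] using this

/-- Rank-one frames have large nullity. -/
lemma le_nul_rankOne (a : ι → α → ℂ) (b : ι → β → ℂ) (ha : ∀ l, a l ≠ 0) :
    Fintype.card ι ≤ nul (fun l (p : α × β) => a l p.1 * b l p.2) := by
  classical
  let M : (ι → ℂ) →ₗ[ℂ] (α → ι → ℂ) :=
    { toFun := fun x i k => x k * a k i
      map_add' := by intro x y; funext i k; simp [add_mul]
      map_smul' := by intro a x; funext i k; simp; ring }
  have hM : ∀ x, M x ∈ LinearMap.ker (Psi (fun l (p : α × β) => a l p.1 * b l p.2)) := by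
    intro x
    rw [mem_ker_Psi]
    intro i j b
    refine Finset.sum_congr rfl fun m _ => ?_
    simp only [M, LinearMap.coe_mk, AddHom.coe_mk]
    ring
  have := LinearMap.finrank_le_finrank_of_injective (f := M.codRestrict _ hM) ?_
  · rwa [Module.finrank_fintype_fun_eq_card] at this
  rw [← LinearMap.ker_eq_bot, LinearMap.ker_eq_bot']
  intro x hx
  have hx' : M x = 0 := congrArg Subtype.val hx
  funext k
  obtain ⟨i, hi⟩ := Function.ne_iff.1 (ha k)
  have := congrFun (congrFun hx' i) k
  simp only [M, LinearMap.coe_mk, AddHom.coe_mk, Pi.zero_apply, mul_eq_zero] at this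
  rcases this with h | h
  · exact h
  · exact absurd h hi

lemma swp_indep {f : ι → α × β → ℂ} (hf : LinearIndependent ℂ f) :
    LinearIndependent ℂ (swp f) := by
  rw [Fintype.linearIndependent_iff] at hf ⊢
  intro c hc
  apply hf
  funext p
  have := congrFun hc (p.2, p.1)
  simpa [swp] using this

lemma swp_span {f : ι → α × β → ℂ} {g : ι' → α × β → ℂ}
    (hsp : ∀ m, f m ∈ Submodule.span ℂ (Set.range g)) (m : ι) :
    swp f m ∈ Submodule.span ℂ (Set.range (swp g)) := by
  obtain ⟨c, hc⟩ := (Submodule.mem_span_range_iff_exists_fun ℂ).1 (hsp m)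
  refine (Submodule.mem_span_range_iff_exists_fun ℂ).2 ⟨c, ?_⟩
  funext p
  have := congrFun hc (p.2, p.1)
  simpa [swp] using this

lemma continuous_swp : Continuous (swp : (ι → α × β → ℂ) → _) := by
  unfold swp; fun_prop

end frames

section limitframe

variable {α β γ : Type*} [Fintype α] [Fintype β] [Fintype γ]

lemma exists_rankOne_frame (r : ℕ) (hr : r ≤ Fintype.card α * Fintype.card β)
    (S : α → β → γ → ℂ) (hS : rankLE S r) :
    ∃ (a : Fin r → α → ℂ) (b : Fin r → β → ℂ),
      LinearIndependent ℂ (fun l (p : α × β) => a l p.1 * b l p.2) ∧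
      ∀ k, (fun p : α × β => S p.1 p.2 k) ∈
        Submodule.span ℂ (Set.range (fun l (p : α × β) => a l p.1 * b l p.2)) := by
  classical
  obtain ⟨u, v, w, rfl⟩ := hS
  let g : Fin r → α × β → ℂ := fun l p => u l p.1 * v l p.2
  let R : Set (α × β → ℂ) := {f | ∃ (a : α → ℂ) (b : β → ℂ), f = fun p => a p.1 * b p.2}
  have hR : Submodule.span ℂ R = ⊤ := by
    rw [eq_top_iff, ← (Pi.basisFun ℂ (α × β)).span_eq]
    apply Submodule.span_mono
    rintro _ ⟨q, rfl⟩
    refine ⟨Pi.single q.1 1, Pi.single q.2 1, ?_⟩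
    funext p
    rcases p with ⟨p1, p2⟩
    rcases q with ⟨q1, q2⟩
    simp only [Pi.basisFun_apply, Pi.single_apply, Prod.mk.injEq]
    split_ifs <;> simp_all
  have hgR : Set.range g ⊆ R := by
    rintro _ ⟨l, rfl⟩
    exact ⟨u l, v l, rfl⟩
  obtain ⟨b, hbs, hbspan, hbi⟩ := exists_linearIndependent ℂ (Set.range g)
  have hbi' : LinearIndepOn ℂ id b := hbi
  have hbR : b ⊆ R := hbs.trans hgR
  let t := hbi'.extend hbR
  have htR : t ⊆ R := hbi'.extend_subset hbR
  have hbt : b ⊆ t := hbi'.subset_extend hbR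
  have hti : LinearIndepOn ℂ id t := hbi'.linearIndepOn_extend hbR
  have hts : Submodule.span ℂ t = ⊤ := by
    rw [eq_top_iff, ← hR, Submodule.span_le]
    exact hbi'.subset_span_extend hbR
  have htf : t.Finite := hti.setFinite
  have hbf : b.Finite := htf.subset hbt
  have hbc : hbf.toFinset.card ≤ r := by
    have h1 : hbf.toFinset ⊆ Finset.univ.image g := by
      intro x hx
      simpa using hbs (by simpa using hx)
    refine (Finset.card_le_card h1).trans (Finset.card_image_le.trans (by simp))
  have htc : r ≤ htf.toFinset.card := by
    have h1 := finrank_span_finset_le_card (R := ℂ) htf.toFinset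
    rw [htf.coe_toFinset, Set.finrank, hts, finrank_top, Module.finrank_fintype_fun_eq_card,
      Fintype.card_prod] at h1
    exact hr.trans h1
  obtain ⟨m, hbm, hmt, hmc⟩ := Finset.exists_subsuperset_card_eq
    (s := hbf.toFinset) (t := htf.toFinset) (by simpa using hbt) hbc htc
  let e : Fin r ≃ m := (m.equivFinOfCardEq hmc).symm
  have hmR : ∀ x : m, ∃ (a : α → ℂ) (b : β → ℂ), x.1 = fun p => a p.1 * b p.2 := fun x =>
    htR (by simpa using hmt x.2)
  choose A B hAB using hmR
  have he : (fun l (p : α × β) => A (e l) p.1 * B (e l) p.2) = fun l => (e l).1 := by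
    funext l; rw [hAB (e l)]
  refine ⟨fun l => A (e l), fun l => B (e l), ?_, ?_⟩
  · show LinearIndependent ℂ (fun l (p : α × β) => A (e l) p.1 * B (e l) p.2)
    rw [he]
    have hmi : LinearIndepOn ℂ id (m : Set (α × β → ℂ)) := hti.mono (by
      intro x hx; simpa using hmt hx)
    exact LinearIndependent.comp hmi e e.injective
  · intro k
    show _ ∈ Submodule.span ℂ (Set.range (fun l (p : α × β) => A (e l) p.1 * B (e l) p.2))
    rw [he]
    have h1 : Submodule.span ℂ (Set.range g) ≤ Submodule.span ℂ (Set.range fun l => (e l).1) := by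
      rw [← hbspan]
      apply Submodule.span_mono
      intro x hx
      exact ⟨e.symm ⟨x, hbm (by simpa using hx)⟩, by simp⟩
    apply h1
    have : (fun p : α × β => ∑ l, u l p.1 * v l p.2 * w l k) = ∑ l, w l k • g l := by
      funext p
      simp [g, mul_comm]
    rw [this]
    exact Submodule.sum_mem _ fun l _ => Submodule.smul_mem _ _ (Submodule.subset_span ⟨l, rfl⟩)

/-- Orthonormal frames. -/
def ONF (r : ℕ) (π : Type*) [Fintype π] : Set (Fin r → π → ℂ) :=
  {f | ∀ m m', ∑ p, starRingEnd ℂ (f m p) * f m' p = if m = m' then 1 else 0}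

lemma isCompact_ONF (r : ℕ) (π : Type*) [Fintype π] : IsCompact (ONF r π) := by
  have hcl : IsClosed (ONF r π) := by
    have : ONF r π = ⋂ m, ⋂ m', {f | ∑ p, starRingEnd ℂ (f m p) * f m' p =
      if m = m' then 1 else 0} := by ext f; simp [ONF]
    rw [this]
    refine isClosed_iInter fun m => isClosed_iInter fun m' => isClosed_eq ?_ continuous_const
    fun_prop
  refine Metric.isCompact_of_isClosed_isBounded hcl ?_
  rw [isBounded_iff_forall_norm_le]
  refine ⟨1, fun f hf => ?_⟩
  rw [pi_norm_le_iff_of_nonneg zero_le_one]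
  intro m
  rw [pi_norm_le_iff_of_nonneg zero_le_one]
  intro p
  have h := hf m m
  simp only [if_true] at h
  have h2 : ∑ p, ‖f m p‖ ^ 2 = 1 := by
    have h3 : ∀ p, starRingEnd ℂ (f m p) * f m p = ((‖f m p‖ ^ 2 : ℝ) : ℂ) := by
      intro p; rw [mul_comm, Complex.mul_conj, Complex.normSq_eq_norm_sq]
    simp only [h3] at h
    exact_mod_cast h
  have h4 : ‖f m p‖ ^ 2 ≤ 1 := by
    rw [← h2]
    exact Finset.single_le_sum (f := fun p => ‖f m p‖ ^ 2) (fun _ _ => sq_nonneg _)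
      (Finset.mem_univ p)
  nlinarith [norm_nonneg (f m p)]

lemma ONF_coeff {r : ℕ} {π : Type*} [Fintype π] {f : Fin r → π → ℂ} (hf : f ∈ ONF r π)
    (c : Fin r → ℂ) (m : Fin r) :
    ∑ p, starRingEnd ℂ (f m p) * ∑ l, c l * f l p = c m := by
  simp only [Finset.mul_sum]
  rw [Finset.sum_comm]
  have : ∀ l, ∑ p, starRingEnd ℂ (f m p) * (c l * f l p) = c l * if m = l then 1 else 0 := by
    intro l
    rw [← hf m l, Finset.mul_sum]
    refine Finset.sum_congr rfl fun p _ => by ring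
  simp [this]

lemma ONF_indep {r : ℕ} {π : Type*} [Fintype π] {f : Fin r → π → ℂ} (hf : f ∈ ONF r π) :
    LinearIndependent ℂ f := by
  rw [Fintype.linearIndependent_iff]
  intro c hc m
  rw [← ONF_coeff hf c m]
  have : ∀ p, ∑ l, c l * f l p = 0 := fun p => by simpa using congrFun hc p
  simp [this]

lemma exists_ONF {r : ℕ} {π : Type*} [Fintype π] (g : Fin r → π → ℂ)
    (hg : LinearIndependent ℂ g) : ∃ f ∈ ONF r π, ∀ m, g m ∈ Submodule.span ℂ (Set.range f) := by
  classical
  let L : (π → ℂ) ≃ₗ[ℂ] EuclideanSpace ℂ π := (WithLp.linearEquiv 2 ℂ (π → ℂ)).symm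
  have hg' : LinearIndependent ℂ (fun m => L (g m)) :=
    hg.map' L.toLinearMap (LinearMap.ker_eq_bot_of_injective L.injective)
  let E := Submodule.span ℂ (Set.range fun m => L (g m))
  have hE : Module.finrank ℂ E = r := by
    have := finrank_span_eq_card hg'
    simpa using this
  let b := (stdOrthonormalBasis ℂ E).reindex (finCongr hE)
  refine ⟨fun m => L.symm (b m).1, ?_, ?_⟩
  · intro m m'
    have := orthonormal_iff_ite.1 b.orthonormal m m'
    rw [← this]
    simp only [Submodule.coe_inner, PiLp.inner_apply, RCLike.inner_apply]
    refine Finset.sum_congr rfl fun p _ => ?_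
    rw [mul_comm]; rfl
  · intro m
    have hm : L (g m) ∈ E := Submodule.subset_span ⟨m, rfl⟩
    have h1 := b.sum_repr ⟨L (g m), hm⟩
    have h2 := congrArg (fun x : E => L.symm x.1) h1
    simp only [Submodule.coe_sum, Submodule.coe_smul, map_sum, map_smul,
      LinearEquiv.symm_apply_apply] at h2
    rw [← h2]
    exact Submodule.sum_mem _ fun l _ => Submodule.smul_mem _ _ (Submodule.subset_span ⟨l, rfl⟩)

lemma exists_frame_of_closure (r : ℕ) (hr : r ≤ Fintype.card α * Fintype.card β)
    (T : α → β → γ → ℂ) (hT : T ∈ closure {S : α → β → γ → ℂ | rankLE S r}) :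
    ∃ f : Fin r → α × β → ℂ, LinearIndependent ℂ f ∧
      (∀ k, (fun p : α × β => T p.1 p.2 k) ∈ Submodule.span ℂ (Set.range f)) ∧
      r ≤ nul f ∧ r ≤ nul (swp f) := by
  classical
  have : CompactSpace (ONF r (α × β)) := isCompact_iff_compactSpace.1 (isCompact_ONF _ _)
  let C : Set (ONF r (α × β) × (α → β → γ → ℂ)) :=
    {x | (∀ k p, x.2 p.1 p.2 k = ∑ m, (∑ q, starRingEnd ℂ (x.1.1 m q) * x.2 q.1 q.2 k) * x.1.1 m p)
      ∧ r ≤ nul x.1.1 ∧ r ≤ nul (swp x.1.1)}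
  have hC : IsClosed C := by
    refine IsClosed.inter ?_ (IsClosed.inter ?_ ?_)
    · show IsClosed {x : ONF r (α × β) × (α → β → γ → ℂ) | _}
      simp only [Set.ofPred_forall]
      have hent : ∀ m q, Continuous fun x : ONF r (α × β) × (α → β → γ → ℂ) => x.1.1 m q :=
        fun m q => (continuous_apply_apply m q).comp (continuous_subtype_val.comp continuous_fst)
      refine isClosed_iInter fun k => isClosed_iInter fun p => isClosed_eq (by fun_prop) ?_
      refine continuous_finsetSum _ fun m _ => Continuous.mul ?_ (hent m p)
      refine continuous_finsetSum _ fun q _ => Continuous.mul ?_ (by fun_prop)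
      exact Complex.continuous_conj.comp (hent m q)
    · exact (isClosed_nul r).preimage (continuous_subtype_val.comp continuous_fst)
    · exact (isClosed_nul r).preimage
        (continuous_swp.comp (continuous_subtype_val.comp continuous_fst))
  have hP : IsClosed (Prod.snd '' C) := isClosedMap_snd_of_compactSpace _ hC
  have hsub : {S : α → β → γ → ℂ | rankLE S r} ⊆ Prod.snd '' C := by
    intro S hS
    obtain ⟨a, b, hi, hsp⟩ := exists_rankOne_frame r hr S hS
    obtain ⟨f, hf, hgf⟩ := exists_ONF _ hi
    refine ⟨(⟨f, hf⟩, S), ⟨?_, ?_, ?_⟩, rfl⟩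
    · intro k p
      have h1 : (fun p : α × β => S p.1 p.2 k) ∈ Submodule.span ℂ (Set.range f) := by
        refine (Submodule.span_le.2 ?_) (hsp k)
        rintro _ ⟨m, rfl⟩
        exact hgf m
      obtain ⟨c, hc⟩ := (Submodule.mem_span_range_iff_exists_fun ℂ).1 h1
      have hc' : ∀ p : α × β, S p.1 p.2 k = ∑ l, c l * f l p := fun p => by
        have := congrFun hc p
        simpa using this.symm
      show S p.1 p.2 k = ∑ m, (∑ q : α × β, starRingEnd ℂ (f m q) * S q.1 q.2 k) * f m p
      simp only [hc', ONF_coeff hf]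
    · refine le_trans ?_ (nul_le_of_span _ f hi hgf)
      have := le_nul_rankOne a b (fun l h0 => hi.ne_zero l (by funext p; simp [h0]))
      simpa using this
    · refine le_trans ?_ (nul_le_of_span _ (swp f) (swp_indep hi) (swp_span hgf))
      have := le_nul_rankOne b a (fun l h0 => hi.ne_zero l (by funext p; simp [h0]))
      refine le_trans (by simpa using this) (le_of_eq ?_)
      congr 1
      funext l p
      simp [swp, mul_comm]
  obtain ⟨⟨f, S⟩, ⟨h1, h2, h3⟩, rfl⟩ := closure_minimal hsub hP hT
  refine ⟨f.1, ONF_indep f.2, fun k => ?_, h2, h3⟩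
  refine (Submodule.mem_span_range_iff_exists_fun ℂ).2
    ⟨fun m => ∑ q : α × β, starRingEnd ℂ (f.1 m q) * S q.1 q.2 k, ?_⟩
  funext p
  have := h1 k p
  simpa using this.symm

end limitframe

section torus

variable {α β K : Type*} [Fintype α] [Fintype β] [Fintype K] [DecidableEq α] [DecidableEq β]

/-- The torus-fixed frame. -/
def limFrame (D : K → α × β → ℂ) (S : Finset (α × β)) : K ⊕ S → α × β → ℂ :=
  Sum.elim D (fun s p => if p = s.1 then 1 else 0)

lemma torus_limit (r : ℕ) (f : Fin r → α × β → ℂ) (hf : LinearIndependent ℂ f)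
    (h1 : r ≤ nul f) (h2 : r ≤ nul (swp f))
    (D : K → α × β → ℂ) (hD : ∀ k, D k ∈ Submodule.span ℂ (Set.range f))
    (wa : α → ℕ) (wb : β → ℕ) (d : K → ℕ) (hDd : ∀ k p, wa p.1 + wb p.2 ≠ d k → D k p = 0)
    (P : K → α × β) (hDP1 : ∀ k, D k (P k) = 1) (hDP0 : ∀ k k', k ≠ k' → D k (P k') = 0)
    (hinj : ∀ p q : α × β, p ∉ Set.range P → q ∉ Set.range P →
      wa p.1 + wb p.2 = wa q.1 + wb q.2 → p = q) :
    ∃ S : Finset (α × β), (∀ k, P k ∉ S) ∧ Fintype.card K + S.card = r ∧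
      r ≤ nul (limFrame D S) ∧ r ≤ nul (swp (limFrame D S)) := by
  classical
  set wt : α × β → ℕ := fun p => wa p.1 + wb p.2 with hwt
  set E := Submodule.span ℂ (Set.range f) with hE
  have hEr : Module.finrank ℂ E = r := by
    simpa using finrank_span_eq_card hf
  let S : Finset (α × β) := Finset.univ.filter fun q => q ∉ Set.range P ∧
    ∃ g ∈ E, (∀ k, g (P k) = 0) ∧ g q = 1 ∧ ∀ q', wt q' < wt q → g q' = 0
  have hSP : ∀ s : S, s.1 ∉ Set.range P := fun s => (Finset.mem_filter.1 s.2).2.1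
  have hSg : ∀ s : S, ∃ g ∈ E, (∀ k, g (P k) = 0) ∧ g s.1 = 1 ∧ ∀ q', wt q' < wt s.1 → g q' = 0 :=
    fun s => (Finset.mem_filter.1 s.2).2.2
  choose G hGE hGP hG1 hG0 using hSg
  let g : K ⊕ S → α × β → ℂ := Sum.elim D G
  have hgE : ∀ m, g m ∈ E := by
    rintro (k | s)
    · exact hD k
    · exact hGE s
  have hgi : LinearIndependent ℂ g := by
    rw [Fintype.linearIndependent_iff]
    intro c hc
    have hc' : ∀ p, ∑ k, c (Sum.inl k) * D k p + ∑ s, c (Sum.inr s) * G s p = 0 := by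
      intro p
      have := congrFun hc p
      simpa [Fintype.sum_sum_type, g] using this
    have hl : ∀ k, c (Sum.inl k) = 0 := by
      intro k
      have := hc' (P k)
      simp only [hGP, mul_zero, Finset.sum_const_zero, add_zero] at this
      rw [Finset.sum_eq_single k] at this
      · simpa [hDP1] using this
      · intro b _ hb; rw [hDP0 b k hb, mul_zero]
      · simp
    have hr : ∀ s, c (Sum.inr s) = 0 := by
      by_contra hne
      push Not at hne
      obtain ⟨s1, hs1⟩ := hne
      obtain ⟨s0, hs0, hmin⟩ := Finset.exists_min_image
        (Finset.univ.filter fun s : S => c (Sum.inr s) ≠ 0) (fun s => wt s.1)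
        ⟨s1, by simpa using hs1⟩
      have := hc' s0.1
      simp only [hl, zero_mul, Finset.sum_const_zero, zero_add] at this
      rw [Finset.sum_eq_single s0] at this
      · rw [hG1, mul_one] at this
        exact (Finset.mem_filter.1 hs0).2 this
      · intro s _ hs
        by_cases hcs : c (Sum.inr s) = 0
        · rw [hcs, zero_mul]
        · have hle := hmin s (by simpa using hcs)
          rcases hle.lt_or_eq with hlt | heq
          · rw [hG0 s _ hlt, mul_zero]
          · exact absurd (Subtype.ext (hinj _ _ (hSP s0) (hSP s) heq)).symm hs
      · simp
    rintro (k | s)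
    · exact hl k
    · exact hr s
  have hle : Submodule.span ℂ (Set.range g) ≤ E := by
    rw [Submodule.span_le]; rintro _ ⟨m, rfl⟩; exact hgE m
  have hgr := finrank_span_eq_card hgi
  have hcard : Fintype.card (K ⊕ S) = Fintype.card K + S.card := by simp
  have hup : r ≤ Fintype.card (K ⊕ S) := by
    let ρ : E →ₗ[ℂ] (K ⊕ S → ℂ) :=
      { toFun := fun x => Sum.elim (fun k => x.1 (P k)) (fun s => x.1 s.1)
        map_add' := by intro x y; funext m; rcases m with k | s <;> simp
        map_smul' := by intro x y; funext m; rcases m with k | s <;> simp }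
    have hρ : Function.Injective ρ := by
      rw [← LinearMap.ker_eq_bot, LinearMap.ker_eq_bot']
      intro x hx
      have hxP : ∀ k, x.1 (P k) = 0 := fun k => congrFun hx (Sum.inl k)
      have hxS : ∀ s : S, x.1 s.1 = 0 := fun s => congrFun hx (Sum.inr s)
      by_contra hne
      have hne' : x.1 ≠ 0 := fun h => hne (Subtype.ext h)
      obtain ⟨p1, hp1⟩ := Function.ne_iff.1 hne'
      obtain ⟨q, hq, hmin⟩ := Finset.exists_min_image
        (Finset.univ.filter fun p => x.1 p ≠ 0) wt ⟨p1, by simpa using hp1⟩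
      have hq' : x.1 q ≠ 0 := (Finset.mem_filter.1 hq).2
      have hqS : q ∈ S := by
        refine Finset.mem_filter.2 ⟨Finset.mem_univ _, ?_, (x.1 q)⁻¹ • x.1,
          E.smul_mem _ x.2, ?_, ?_, ?_⟩
        · rintro ⟨k, rfl⟩; exact hq' (hxP k)
        · intro k; simp [hxP k]
        · simp [hq']
        · intro q' hlt
          by_contra h0
          have : x.1 q' ≠ 0 := by
            intro h; apply h0; simp [h]
          exact absurd (hmin q' (by simpa using this)) (not_le.2 hlt)
      exact hq' (hxS ⟨q, hqS⟩)
    have := LinearMap.finrank_le_finrank_of_injective hρ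
    rwa [hEr, Module.finrank_fintype_fun_eq_card] at this
  have hlow : Fintype.card (K ⊕ S) ≤ r := by
    rw [← hgr, ← hEr]; exact Submodule.finrank_mono hle
  have hEE : Submodule.span ℂ (Set.range g) = E :=
    Submodule.eq_of_le_of_finrank_eq hle (by rw [hgr, hEr]; omega)
  have hfg : ∀ m, f m ∈ Submodule.span ℂ (Set.range g) := fun m => by
    rw [hEE]; exact Submodule.subset_span ⟨m, rfl⟩
  have hg1 : r ≤ nul g := h1.trans (nul_le_of_span f g hf hfg)
  have hg2 : r ≤ nul (swp g) := h2.trans (nul_le_of_span _ _ (swp_indep hf) (swp_span hfg))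
  -- the curve
  let H : ℂ → K ⊕ S → α × β → ℂ := fun t => Sum.elim D
    (fun s p => if wt p ≤ wt s.1 then (if p = s.1 then 1 else 0) else t ^ (wt p - wt s.1) * G s p)
  have hHc : Continuous H := by
    refine continuous_pi fun m => continuous_pi fun p => ?_
    rcases m with k | s
    · exact continuous_const
    · simp only [H, Sum.elim_inr]
      split_ifs <;> fun_prop
  have hH0 : H 0 = limFrame D S := by
    funext m p
    rcases m with k | s
    · rfl
    · simp only [H, Sum.elim_inr, limFrame]
      split_ifs with ha hb hb
      · rfl
      · rfl
      · subst hb; exact absurd le_rfl ha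
      · rw [zero_pow (by omega), zero_mul]
  let cc : ℂ → K ⊕ S → ℂ := fun t => Sum.elim (fun k => (t ^ d k)⁻¹) (fun s => (t ^ wt s.1)⁻¹)
  have hHt : ∀ t : ℂ, t ≠ 0 → H t =
      fun m (p : α × β) => cc t m * (t ^ wa p.1 * t ^ wb p.2 * g m p) := by
    intro t ht
    funext m p
    rw [← pow_add]
    rcases m with k | s
    · simp only [H, cc, g, Sum.elim_inl]
      by_cases hk : wa p.1 + wb p.2 = d k
      · rw [hk]; field_simp
      · rw [hDd k p hk]; simp
    · simp only [H, cc, g, Sum.elim_inr]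
      show _ = (t ^ wt s.1)⁻¹ * (t ^ wt p * _)
      split_ifs with ha hb
      · rw [hb, hG1]; field_simp
      · have : G s p = 0 := by
          rcases ha.lt_or_eq with hlt | heq
          · exact hG0 s p hlt
          · by_cases hp : p ∈ Set.range P
            · obtain ⟨k, rfl⟩ := hp; exact hGP s k
            · exact absurd (hinj _ _ hp (hSP s) heq) hb
        simp [this]
      · have : wt p = wt s.1 + (wt p - wt s.1) := by omega
        rw [show t ^ wt p = t ^ wt s.1 * t ^ (wt p - wt s.1) by rw [← pow_add, ← this]]
        field_simp
  have hcc : ∀ t : ℂ, t ≠ 0 → ∀ m, cc t m ≠ 0 := by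
    intro t ht m
    rcases m with k | s <;> simp [cc, ht]
  have hn1 : ∀ t : ℂ, t ≠ 0 → r ≤ nul (H t) := by
    intro t ht
    rw [hHt t ht]
    exact hg1.trans (nul_le_scale g (fun i => t ^ wa i) (fun j => t ^ wb j) (cc t)
      (fun i => pow_ne_zero _ ht) (hcc t ht))
  have hn2 : ∀ t : ℂ, t ≠ 0 → r ≤ nul (swp (H t)) := by
    intro t ht
    rw [hHt t ht]
    refine hg2.trans ((nul_le_scale (swp g) (fun i => t ^ wb i) (fun j => t ^ wa j) (cc t)
      (fun i => pow_ne_zero _ ht) (hcc t ht)).trans (le_of_eq ?_))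
    congr 1
    funext m p
    simp only [swp]; ring
  have hdense : ∀ A : Set ℂ, IsClosed A → (∀ t, t ≠ 0 → t ∈ A) → (0 : ℂ) ∈ A := by
    intro A hA h
    have h1 : closure ({0}ᶜ : Set ℂ) ⊆ A := closure_minimal (fun t ht => h t ht) hA
    rw [(dense_compl_singleton (0 : ℂ)).closure_eq] at h1
    exact h1 (Set.mem_univ _)
  refine ⟨S, fun k hk => hSP ⟨_, hk⟩ ⟨k, rfl⟩, by omega, ?_, ?_⟩
  · rw [← hH0]
    exact hdense _ ((isClosed_nul r).preimage hHc) hn1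
  · rw [← hH0]
    exact hdense _ ((isClosed_nul r).preimage (continuous_swp.comp hHc)) hn2

end torus

section matmul

/-- The slices of the matrix multiplication tensor. -/
def Dmm (n m : ℕ) : Fin n × Fin m → (Fin n × Fin 2) × (Fin 2 × Fin m) → ℂ :=
  fun k p => if p.1.1 = k.1 ∧ p.2.2 = k.2 ∧ p.1.2 = p.2.1 then 1 else 0

variable {n m : ℕ} (S : Finset ((Fin n × Fin 2) × (Fin 2 × Fin m)))

lemma lim_eval (x : (Fin n × Fin m) ⊕ S → ℂ) (u : Fin n) (v v' : Fin 2) (w : Fin m) :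
    ∑ k, x k * limFrame (Dmm n m) S k ((u, v), (v', w)) =
      (if v = v' then x (Sum.inl (u, w)) else 0) +
      (if h : ((u, v), (v', w)) ∈ S then x (Sum.inr ⟨_, h⟩) else 0) := by
  classical
  rw [Fintype.sum_sum_type]
  congr 1
  · simp only [limFrame, Sum.elim_inl, Dmm]
    rw [Finset.sum_eq_single (u, w)]
    · simp
    · rintro ⟨a, b⟩ _ hne
      have : ¬ (u = a ∧ w = b ∧ v = v') := by
        rintro ⟨rfl, rfl, _⟩; exact hne rfl
      simp [this]
    · simp
  · simp only [limFrame, Sum.elim_inr]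
    split_ifs with h
    · rw [Finset.sum_eq_single ⟨_, h⟩]
      · simp
      · intro s _ hs
        rw [if_neg, mul_zero]
        intro h'; exact hs (Subtype.ext h'.symm)
      · simp
    · apply Finset.sum_eq_zero
      intro s _
      rw [if_neg, mul_zero]
      intro h'; exact h (h' ▸ s.2)

lemma lim_zero (hS : ∀ u w, ((u, (1 : Fin 2)), ((1 : Fin 2), w)) ∉ S)
    (x : (Fin n × Fin m) ⊕ S → ℂ)
    (hx : ∀ u v v' w, ∑ k, x k * limFrame (Dmm n m) S k ((u, v), (v', w)) = 0) : x = 0 := by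
  have hl : ∀ u w, x (Sum.inl (u, w)) = 0 := by
    intro u w
    have := hx u 1 1 w
    rw [lim_eval, dif_neg (hS u w)] at this
    simpa using this
  funext k
  rcases k with ⟨u, w⟩ | ⟨⟨⟨u, v⟩, ⟨v', w⟩⟩, h⟩
  · exact hl u w
  · have := hx u v v' w
    rw [lim_eval, dif_pos h, hl] at this
    simpa using this

lemma nul_bound1 (hS : ∀ u w, ((u, (1 : Fin 2)), ((1 : Fin 2), w)) ∉ S)
    : nul (limFrame (Dmm n m) S) ≤ totB (fun u w =>
    cnt (decide (((u, 0), (1, w)) ∈ S)) (decide (((u, 0), (0, w)) ∈ S))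
      (decide (((u, 1), (0, w)) ∈ S))) := by
  let Φ : LinearMap.ker (Psi (limFrame (Dmm n m) S)) →ₗ[ℂ]
      (Fin n → Fin 2 → Fin n → Fin 2 → Fin 2 → Fin m → ℂ) :=
    { toFun := fun x u v u' v' y w =>
        ∑ k, x.1 (u, v) k * limFrame (Dmm n m) S k ((u', v'), (y, w))
      map_add' := by
        intro x y; funext u v u' v' z w
        simp [add_mul, Finset.sum_add_distrib]
      map_smul' := by
        intro c x; funext u v u' v' z w
        simp [-Fintype.sum_sum_type, Finset.mul_sum, mul_assoc] }
  have hΦ : ∀ x u v u' v' y w, Φ x u v u' v' y w =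
    ∑ k, x.1 (u, v) k * limFrame (Dmm n m) S k ((u', v'), (y, w)) := fun _ _ _ _ _ _ _ => rfl
  refine symBound _ _ _ Φ ?_ ?_ ?_ ?_ ?_
  · rw [← LinearMap.ker_eq_bot, LinearMap.ker_eq_bot']
    intro x hx
    apply Subtype.ext
    funext ⟨u, v⟩
    apply lim_zero S hS
    intro u' v' y w
    rw [← hΦ, hx]; rfl
  · intro x u v u' v' y w
    exact (mem_ker_Psi _ _).1 x.2 (u, v) (u', v') (y, w)
  · intro x u v u' w h
    rw [hΦ, lim_eval, dif_neg (by simpa using h)]; simp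
  · intro x u v u' w h
    rw [hΦ, lim_eval, dif_neg (by simpa using h)]; simp
  · intro x u v u' w h
    rw [hΦ, hΦ, lim_eval, lim_eval, dif_neg (by simpa using h), dif_neg (hS u' w)]; simp

lemma nul_bound2 (hS : ∀ u w, ((u, (1 : Fin 2)), ((1 : Fin 2), w)) ∉ S)
    : nul (swp (limFrame (Dmm n m) S)) ≤ totB (fun w u =>
    cnt (decide (((u, 1), (0, w)) ∈ S)) (decide (((u, 0), (0, w)) ∈ S))
      (decide (((u, 0), (1, w)) ∈ S))) := by
  let Φ : LinearMap.ker (Psi (swp (limFrame (Dmm n m) S))) →ₗ[ℂ]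
      (Fin m → Fin 2 → Fin m → Fin 2 → Fin 2 → Fin n → ℂ) :=
    { toFun := fun x w v w' v' y u =>
        ∑ k, x.1 (v, w) k * limFrame (Dmm n m) S k ((u, y), (v', w'))
      map_add' := by
        intro x y; funext u v u' v' z w
        simp [add_mul, Finset.sum_add_distrib]
      map_smul' := by
        intro c x; funext u v u' v' z w
        simp [-Fintype.sum_sum_type, Finset.mul_sum, mul_assoc] }
  have hΦ : ∀ x w v w' v' y u, Φ x w v w' v' y u =
    ∑ k, x.1 (v, w) k * limFrame (Dmm n m) S k ((u, y), (v', w')) := fun _ _ _ _ _ _ _ => rfl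
  refine symBound _ _ _ Φ ?_ ?_ ?_ ?_ ?_
  · rw [← LinearMap.ker_eq_bot, LinearMap.ker_eq_bot']
    intro x hx
    apply Subtype.ext
    funext ⟨v, w⟩
    apply lim_zero S hS
    intro u y v' w'
    rw [← hΦ, hx]; rfl
  · intro x w v w' v' y u
    exact (mem_ker_Psi _ _).1 x.2 (v, w) (v', w') (u, y)
  · intro x w v w' u h
    rw [hΦ, lim_eval, dif_neg (by simpa using h)]; simp
  · intro x w v w' u h
    rw [hΦ, lim_eval, dif_neg (by simpa using h)]; simp
  · intro x w v w' u h
    rw [hΦ, hΦ, lim_eval, lim_eval, dif_neg (by simpa using h), dif_neg (hS u w')]; simp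

lemma sum_cnt (hS : ∀ u w, ((u, (1 : Fin 2)), ((1 : Fin 2), w)) ∉ S)
    : ∑ u, ∑ w, cnt (decide (((u, 0), (1, w)) ∈ S)) (decide (((u, 0), (0, w)) ∈ S))
      (decide (((u, 1), (0, w)) ∈ S)) = S.card := by
  have h0 : S.card = ∑ p, (decide (p ∈ S)).toNat := by
    simp [Bool.toNat, Bool.cond_decide]
  rw [h0]
  simp only [Fintype.sum_prod_type, Fin.sum_univ_two, cnt]
  refine Finset.sum_congr rfl fun u _ => ?_
  simp only [hS, Finset.sum_add_distrib]
  simp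
  omega

end matmul

lemma exists_table (n m r : ℕ) (hm : m ≤ 3) (hr : r ≤ n * 2 * (2 * m))
    (hT : matMulTensor n 2 m ∈ closure {T | rankLE T r}) :
    ∃ c : Fin n → Fin m → ℕ, n * m + ∑ u, ∑ w, c u w = r ∧ r ≤ totB c ∧
      r ≤ totB (fun w u => c u w) := by
  obtain ⟨f, hfi, hfs, h1, h2⟩ := exists_frame_of_closure r (by simpa using hr) _ hT
  have hD : ∀ k, Dmm n m k ∈ Submodule.span ℂ (Set.range f) := by
    rintro ⟨u, w⟩
    convert hfs (w, u) using 1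
    funext p
    simp only [Dmm, matMulTensor]
    refine if_congr ?_ rfl rfl
    constructor
    · rintro ⟨a, b, c⟩; exact ⟨c, b, a.symm⟩
    · rintro ⟨a, b, c⟩; exact ⟨c.symm, b, a⟩
  obtain ⟨S, hS, hc, hn1, hn2⟩ := torus_limit r f hfi h1 h2 (Dmm n m) hD
    (fun i => 9 * i.1.1 + 3 * i.2.1) (fun j => j.2.1 + 3 * (1 - j.1.1))
    (fun k => 9 * k.1.1 + k.2.1 + 3)
    (by
      rintro ⟨u, w⟩ ⟨⟨a, v⟩, ⟨v', b⟩⟩ h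
      rw [Dmm, if_neg]
      rintro ⟨h1, h2, h3⟩
      apply h
      simp only at h1 h2 h3 ⊢
      subst h1 h2 h3
      have := v.2
      omega)
    (fun k => ((k.1, 1), (1, k.2)))
    (by intro k; simp [Dmm])
    (by
      rintro ⟨u, w⟩ ⟨u', w'⟩ h
      rw [Dmm, if_neg]
      rintro ⟨h1, h2, h3⟩
      apply h
      simp only at h1 h2
      rw [h1, h2])
    (by
      rintro ⟨⟨a, v⟩, ⟨v', b⟩⟩ ⟨⟨a2, v2⟩, ⟨v2', b2⟩⟩ hp hq h
      have hp' : ¬ (v = 1 ∧ v' = 1) := by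
        rintro ⟨rfl, rfl⟩; exact hp ⟨(a, b), rfl⟩
      have hq' : ¬ (v2 = 1 ∧ v2' = 1) := by
        rintro ⟨rfl, rfl⟩; exact hq ⟨(a2, b2), rfl⟩
      simp only [Fin.ext_iff, Fin.val_one, Prod.mk.injEq] at *
      have := a.2; have := a2.2; have := b.2; have := b2.2
      have := v.2; have := v2.2; have := v'.2; have := v2'.2
      omega)
  have hS' : ∀ u w, ((u, (1 : Fin 2)), ((1 : Fin 2), w)) ∉ S := fun u w => hS (u, w)
  refine ⟨_, ?_, hn1.trans (nul_bound1 S hS'), hn2.trans ((nul_bound2 S hS').trans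
    (le_of_eq ?_))⟩
  · rw [sum_cnt S hS']
    simpa using hc
  · congr 1
    funext w u
    simp only [cnt]; omega

lemma rankLE_mono {ι₁ ι₂ ι₃ : Type*} {T : ι₁ → ι₂ → ι₃ → ℂ} {r s : ℕ} (hrs : r ≤ s)
    (h : rankLE T r) : rankLE T s := by
  obtain ⟨u, v, w, rfl⟩ := h
  obtain ⟨k, rfl⟩ := Nat.exists_eq_add_of_le hrs
  refine ⟨Fin.append u 0, Fin.append v 0, Fin.append w 0, ?_⟩
  funext i j l
  rw [Fin.sum_univ_add]
  simp

lemma lower_223 : matMulTensor 2 2 3 ∉ closure {T | rankLE T 9} := by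
  intro h
  obtain ⟨c, hc, h1, h2⟩ := exists_table 2 3 9 le_rfl (by norm_num) h
  rcases comb23 c (by omega) with h | h <;> omega

lemma lower_323 : matMulTensor 3 2 3 ∉ closure {T | rankLE T 13} := by
  intro h
  obtain ⟨c, hc, h1, h2⟩ := exists_table 3 3 13 le_rfl (by norm_num) h
  rcases comb33 c (by omega) with h | h <;> omega

lemma lower_233 : matMulTensor 2 3 3 ∉ closure {T | rankLE T 13} := by
  intro h
  apply lower_323
  let R : ((Fin 2 × Fin 3) → (Fin 3 × Fin 3) → (Fin 3 × Fin 2) → ℂ) →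
      ((Fin 3 × Fin 2) → (Fin 2 × Fin 3) → (Fin 3 × Fin 3) → ℂ) := fun T z x y => T x y z
  have hR : Continuous R := by
    refine continuous_pi fun z => continuous_pi fun x => continuous_pi fun y => ?_
    simp only [R]; fun_prop
  have hRT : R (matMulTensor 2 3 3) = matMulTensor 3 2 3 := by
    funext z x y
    simp only [R, matMulTensor]
    refine if_congr ?_ rfl rfl
    tauto
  have := map_mem_closure hR h (t := {T | rankLE T 13}) (by
    rintro T ⟨u, v, w, rfl⟩
    refine ⟨w, u, v, ?_⟩
    funext z x y
    simp only [R]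
    refine Finset.sum_congr rfl fun l _ => by ring)
  rwa [hRT] at this

lemma brank_eq {ι₁ ι₂ ι₃ : Type*} [Fintype ι₁] [Fintype ι₂] [Fintype ι₃]
    (T : ι₁ → ι₂ → ι₃ → ℂ) (r : ℕ) (hu : T ∈ closure {S | rankLE S (r + 1)})
    (hl : T ∉ closure {S | rankLE S r}) : brank T = r + 1 := by
  apply le_antisymm
  · exact Nat.sInf_le hu
  · refine le_csInf ⟨_, hu⟩ fun s hs => ?_
    by_contra hlt
    exact hl (closure_mono (fun S hS => rankLE_mono (by omega) hS) hs)

/-- `BR(M⟨2,2,3⟩) = 10` and `BR(M⟨2,3,3⟩) = 14`. -/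
theorem borderRank_matMul_223_233 :
    brank (matMulTensor 2 2 3) = 10 ∧ brank (matMulTensor 2 3 3) = 14 :=
  ⟨brank_eq _ 9 upper_223 lower_223, brank_eq _ 13 upper_233 lower_233⟩

end
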